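/- Fix β ∈ (0,1), α = √(1−β²), x₁, x₂ ∈ ℝ with x₁ ≠ (π/α)(1/2+k) for every integer k. Let B, Bₜ be the breather profile and K, Kₜ the complex kink profile with parameters (β, x₁, x₂), and write B_{t,x} = (Bₜ)′ for the x-derivative of Bₜ and K′ for the x-derivative of K. Then all four integrals below converge absolutely and: i·Im(∫_ℝ B_{t,x}(x) K′(x) dx) − i·Im(∫_ℝ B(x) Kₜ(x) dx) − (1/(β+iα))·∫_ℝ (B(x) − B_{t,x}(x))·sin((B(x)+K(x))/2) dx − (β+iα)·∫_ℝ (B(x) + B_{t,x}(x))·sin((B(x)−K(x))/2) dx = 0, where Im denotes the imaginary part of a complex number. -/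

import Mathlib

open Complex MeasureTheory

/-- The complex arctangent is differentiable off the imaginary axis. -/
lemma Complex.hasDerivAt_arctan_of_re_ne_zero {z : ℂ} (hz : z.re ≠ 0) :
    HasDerivAt Complex.arctan (1 / (1 + z ^ 2)) z := by
  have h₁ : 1 + z * I ≠ 0 := fun h => hz (by simpa using congrArg Complex.im h)
  have h₂ : 1 - z * I ≠ 0 := fun h => hz (by simpa using congrArg Complex.im h)
  have hfac : 1 + z ^ 2 = (1 + z * I) * (1 - z * I) := by
    linear_combination z ^ 2 * I_sq
  have hslit : (1 + z * I) / (1 - z * I) ∈ slitPlane := by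
    refine Or.inr ?_
    have hn : normSq (1 - z * I) ≠ 0 := by simpa using h₂
    have : ((1 + z * I) / (1 - z * I)).im = 2 * z.re / normSq (1 - z * I) := by
      rw [div_im]
      field_simp
      simp
      ring
    rw [this]
    exact div_ne_zero (by simpa using hz) hn
  have hd := ((((hasDerivAt_id z).mul_const I).const_add 1).div
    (((hasDerivAt_id z).mul_const I).const_sub 1) h₂).clog hslit
  refine (hd.const_mul (-I / 2)).congr_deriv ?_
  simp only [id, Pi.div_apply]
  have hnum : 1 * I * (1 - z * I) - (1 + z * I) * -(1 * I) = 2 * I := by ring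
  rw [hfac, hnum]
  generalize 1 + z * I = u at h₁ ⊢
  generalize 1 - z * I = v at h₂ ⊢
  field_simp
  linear_combination -I_sq

lemma Complex.cos_arctan_sq_mul {z : ℂ} (hz : 1 + z ^ 2 ≠ 0) :
    Complex.cos (Complex.arctan z) ^ 2 * (1 + z ^ 2) = 1 ∧
      Complex.sin (Complex.arctan z) = z * Complex.cos (Complex.arctan z) := by
  have h₁ : z ≠ I := by
    rintro rfl
    simp at hz
  have h₂ : z ≠ -I := by
    rintro rfl
    simp at hz
  have ht := Complex.tan_arctan h₁ h₂
  have hsq := Complex.sin_sq_add_cos_sq (Complex.arctan z)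
  rw [Complex.tan] at ht
  have hc : Complex.cos (Complex.arctan z) ≠ 0 := by
    intro h
    rw [h, div_zero] at ht
    rw [← ht] at h
    simp [Complex.arctan] at h
  rw [div_eq_iff hc] at ht
  refine ⟨?_, ht⟩
  rw [ht] at hsq
  linear_combination hsq

lemma Complex.sin_two_mul_arctan {z : ℂ} (hz : 1 + z ^ 2 ≠ 0) :
    Complex.sin (2 * Complex.arctan z) = 2 * z / (1 + z ^ 2) := by
  obtain ⟨h₁, h₂⟩ := Complex.cos_arctan_sq_mul hz
  rw [Complex.sin_two_mul, h₂, eq_div_iff hz]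
  linear_combination 2 * z * h₁

lemma Complex.cos_two_mul_arctan {z : ℂ} (hz : 1 + z ^ 2 ≠ 0) :
    Complex.cos (2 * Complex.arctan z) = (1 - z ^ 2) / (1 + z ^ 2) := by
  obtain ⟨h₁, -⟩ := Complex.cos_arctan_sq_mul hz
  rw [Complex.cos_two_mul, eq_div_iff hz]
  linear_combination 2 * h₁

lemma Complex.one_add_exp_sq (θ : ℂ) :
    1 + Complex.exp θ ^ 2 = 2 * Complex.exp θ * Complex.cosh θ := by
  rw [← Complex.cosh_add_sinh]
  linear_combination -Complex.cosh_sq_sub_sinh_sq θ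

lemma Complex.one_sub_exp_sq (θ : ℂ) :
    1 - Complex.exp θ ^ 2 = -(2 * Complex.exp θ * Complex.sinh θ) := by
  rw [← Complex.cosh_add_sinh]
  linear_combination -Complex.cosh_sq_sub_sinh_sq θ

lemma Complex.sin_two_mul_arctan_exp {θ : ℂ} (hθ : Complex.cosh θ ≠ 0) :
    Complex.sin (2 * Complex.arctan (Complex.exp θ)) = 1 / Complex.cosh θ := by
  have he := Complex.exp_ne_zero θ
  rw [Complex.sin_two_mul_arctan, Complex.one_add_exp_sq]
  · field_simp
  · rw [Complex.one_add_exp_sq]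
    exact mul_ne_zero (mul_ne_zero two_ne_zero he) hθ

lemma Complex.cos_two_mul_arctan_exp {θ : ℂ} (hθ : Complex.cosh θ ≠ 0) :
    Complex.cos (2 * Complex.arctan (Complex.exp θ)) = -Complex.sinh θ / Complex.cosh θ := by
  have he := Complex.exp_ne_zero θ
  rw [Complex.cos_two_mul_arctan, Complex.one_add_exp_sq, Complex.one_sub_exp_sq]
  · field_simp
  · rw [Complex.one_add_exp_sq]
    exact mul_ne_zero (mul_ne_zero two_ne_zero he) hθ

lemma Real.abs_arctan_le_abs (x : ℝ) : |Real.arctan x| ≤ |x| := by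
  have key : ∀ y : ℝ, 0 ≤ y → Real.arctan y ≤ y := fun y hy => by
    have := Real.le_tan (Real.arctan_nonneg.mpr hy) (Real.arctan_lt_pi_div_two y)
    rwa [Real.tan_arctan] at this
  rcases le_total 0 x with hx | hx
  · rw [abs_of_nonneg hx, abs_of_nonneg (Real.arctan_nonneg.mpr hx)]
    exact key x hx
  · have h₁ := key (-x) (neg_nonneg.mpr hx)
    have h₂ := Real.arctan_nonneg.mpr (neg_nonneg.mpr hx)
    rw [Real.arctan_neg] at h₁ h₂
    rw [abs_of_nonpos hx, abs_of_nonpos (neg_nonneg.mp h₂)]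
    exact h₁

lemma integrable_inv_cosh_mul_add {b : ℝ} (hb : b ≠ 0) (a : ℝ) :
    Integrable (fun x : ℝ => (Real.cosh (b * (x + a)))⁻¹) := by
  have h : Integrable (fun x : ℝ => (Real.cosh x)⁻¹) := by
    refine (integrable_inv_one_add_sq.const_mul 2).mono'
      (Real.continuous_cosh.inv₀ fun x => (Real.cosh_pos x).ne').aestronglyMeasurable
      (Filter.Eventually.of_forall fun x => ?_)
    have hc := Real.cosh_pos x
    rw [Real.norm_of_nonneg (by positivity), ← div_eq_mul_inv,
      inv_le_comm₀ hc (by positivity), inv_div]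
    have h₁ := Real.cosh_sq x
    have h₂ := Real.cosh_two_mul (x / 2)
    have h₃ := Real.cosh_sq (x / 2)
    have h₄ : |x / 2| ≤ |Real.sinh (x / 2)| := by
      rw [Real.abs_sinh]
      exact Real.self_le_sinh_iff.mpr (abs_nonneg _)
    have h₅ := sq_le_sq.mpr h₄
    rw [show 2 * (x / 2) = x by ring] at h₂
    nlinarith
  exact (h.comp_mul_left' hb).comp_add_right a

/-- A bounded continuous function times a continuous function dominated by a hyperbolic secant is
integrable. -/
lemma integrable_mul_of_abs_le_div_cosh {b a M M' : ℝ} (hb : b ≠ 0) {φ : ℝ → ℝ} {ψ : ℝ → ℂ}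
    (hφc : Continuous φ) (hψc : Continuous ψ)
    (hφ : ∀ x, |φ x| ≤ M / Real.cosh (b * (x + a))) (hψ : ∀ x, ‖ψ x‖ ≤ M') :
    Integrable (fun x : ℝ => (φ x : ℂ) * ψ x) := by
  refine ((integrable_inv_cosh_mul_add hb a).const_mul (M * M')).mono'
    ((Complex.continuous_ofReal.comp hφc).mul hψc).aestronglyMeasurable
    (Filter.Eventually.of_forall fun x => ?_)
  rw [norm_mul, Complex.norm_real, Real.norm_eq_abs]
  calc |φ x| * ‖ψ x‖ ≤ M / Real.cosh (b * (x + a)) * M' :=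
        mul_le_mul (hφ x) (hψ x) (norm_nonneg _) ((abs_nonneg _).trans (hφ x))
    _ = M * M' * (Real.cosh (b * (x + a)))⁻¹ := by ring

lemma re_integral_eq_zero_of_comp_sub_left {f : ℝ → ℂ} (a : ℝ)
    (hf : ∀ x, f (a - x) = -(starRingEnd ℂ) (f x)) : (∫ x, f x).re = 0 := by
  have h : ∫ x, f x = -(starRingEnd ℂ) (∫ x, f x) := by
    conv_lhs => rw [← integral_sub_left_eq_self f volume a]
    simp_rw [hf]
    rw [integral_neg, integral_conj]
  have := congrArg Complex.re h
  simp at this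
  linarith

lemma integral_eq_zero_of_comp_sub_left {f : ℝ → ℂ} (a : ℝ)
    (hf : ∀ x, f (a - x) = -f x) : ∫ x, f x = 0 := by
  have h : ∫ x, f x = -∫ x, f x := by
    conv_lhs => rw [← integral_sub_left_eq_self f volume a]
    simp_rw [hf]
    rw [integral_neg]
  exact self_eq_neg.mp h

/-- The Bäcklund relations between breather and kink, after inserting the closed forms of all
profiles. -/
lemma backlund_algebra {α β c s S C : ℂ} (hαβ : α ^ 2 + β ^ 2 = 1) (hcs : c ^ 2 - s ^ 2 = 1)
    (hSC : S ^ 2 + C ^ 2 = 1) (hD : α ^ 2 * c ^ 2 + β ^ 2 * S ^ 2 ≠ 0)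
    (hw : c * C + s * S * I ≠ 0) {sB cB sK cK : ℂ}
    (hsB : sB = 2 * α * β * S * c / (α ^ 2 * c ^ 2 + β ^ 2 * S ^ 2))
    (hcB : cB = (α ^ 2 * c ^ 2 - β ^ 2 * S ^ 2) / (α ^ 2 * c ^ 2 + β ^ 2 * S ^ 2))
    (hsK : sK = 1 / (c * C + s * S * I))
    (hcK : cK = -(s * C + c * S * I) / (c * C + s * S * I)) {Bx Bt Kx Kt : ℂ}
    (hBx : Bx = -(4 * β ^ 2 * α * S * s) / (α ^ 2 * c ^ 2 + β ^ 2 * S ^ 2))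
    (hBt : Bt = 4 * α ^ 2 * β * C * c / (α ^ 2 * c ^ 2 + β ^ 2 * S ^ 2))
    (hKx : Kx = 2 * β / (c * C + s * S * I))
    (hKt : Kt = 2 * I * α / (c * C + s * S * I)) :
    sB * cK + cB * sK = (β + I * α) / 2 * ((Bx - Kt) + (Bt - Kx)) ∧
      sB * cK - cB * sK = (β - I * α) / 2 * ((Bx - Kt) - (Bt - Kx)) := by
  set D := α ^ 2 * c ^ 2 + β ^ 2 * S ^ 2 with hDdef
  set w := c * C + s * S * I with hwdef
  have h₁ : (β - I * α) * (sB * cK + cB * sK) + (β + I * α) * (sB * cK - cB * sK) = Bx - Kt := by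
    rw [hsB, hcB, hsK, hcK, hBx, hKt]
    field_simp
    rw [hDdef, hwdef]
    linear_combination (-4 * I * α * β ^ 2 * S ^ 2) * hcs
  have h₂ : (β - I * α) * (sB * cK + cB * sK) - (β + I * α) * (sB * cK - cB * sK) = Bt - Kx := by
    rw [hsB, hcB, hsK, hcK, hBt, hKx]
    field_simp
    rw [hDdef, hwdef]
    linear_combination (-4 * α ^ 2 * β * c ^ 2) * hSC + 4 * α ^ 2 * β * S ^ 2 * c ^ 2 * I_sq
  rw [← h₁, ← h₂]
  constructor
  · linear_combination (-(sB * cK + cB * sK)) * (hαβ - α ^ 2 * I_sq)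
  · linear_combination (-(sB * cK - cB * sK)) * (hαβ - α ^ 2 * I_sq)

/-- **The key cancellation identity (Lemma 7.3).**
With `β ∈ (0,1)`, `α = √(1−β²)` and `x₁` nondegenerate, writing `B_{t,x} = (Bₜ)′`, the
four integrals below converge absolutely and
`i·Im ∫ B_{t,x} K′ − i·Im ∫ B Kₜ − (1/(β+iα)) ∫ (B − B_{t,x}) sin((B+K)/2)
  − (β+iα) ∫ (B + B_{t,x}) sin((B−K)/2) = 0`. -/
theorem breather_kink_cancellation (β x₁ x₂ : ℝ) (hβ0 : 0 < β) (hβ1 : β < 1)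
    (α : ℝ) (hα : α = Real.sqrt (1 - β ^ 2))
    (hx₁ : ∀ k : ℤ, x₁ ≠ (Real.pi / α) * (1 / 2 + (k : ℝ)))
    (B Bt : ℝ → ℝ)
    (hB : ∀ x : ℝ, B x
      = 4 * Real.arctan (β * Real.sin (α * x₁) / (α * Real.cosh (β * (x + x₂)))))
    (hBt : ∀ x : ℝ, Bt x
      = 4 * α ^ 2 * β * Real.cos (α * x₁) * Real.cosh (β * (x + x₂))
          / (α ^ 2 * (Real.cosh (β * (x + x₂))) ^ 2 + β ^ 2 * (Real.sin (α * x₁)) ^ 2))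
    (θ : ℝ → ℂ)
    (hθ : ∀ x : ℝ, θ x = (β : ℂ) * ((x : ℂ) + (x₂ : ℂ)) + Complex.I * (α : ℂ) * (x₁ : ℂ))
    (K Kt : ℝ → ℂ)
    (hK : ∀ x : ℝ, K x = 4 * Complex.arctan (Complex.exp (θ x)))
    (hKt : ∀ x : ℝ, Kt x
      = 4 * Complex.I * (α : ℂ) * Complex.exp (θ x) / (1 + Complex.exp (2 * θ x))) :
    Integrable (fun x : ℝ => ((deriv Bt x : ℝ) : ℂ) * deriv K x) ∧
    Integrable (fun x : ℝ => (B x : ℂ) * Kt x) ∧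
    Integrable (fun x : ℝ =>
      ((B x : ℂ) - ((deriv Bt x : ℝ) : ℂ)) * Complex.sin (((B x : ℂ) + K x) / 2)) ∧
    Integrable (fun x : ℝ =>
      ((B x : ℂ) + ((deriv Bt x : ℝ) : ℂ)) * Complex.sin (((B x : ℂ) - K x) / 2)) ∧
    Complex.I * (((∫ x : ℝ, ((deriv Bt x : ℝ) : ℂ) * deriv K x).im : ℝ) : ℂ)
      - Complex.I * (((∫ x : ℝ, (B x : ℂ) * Kt x).im : ℝ) : ℂ)
      - (1 / ((β : ℂ) + Complex.I * (α : ℂ)))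
        * (∫ x : ℝ, ((B x : ℂ) - ((deriv Bt x : ℝ) : ℂ))
            * Complex.sin (((B x : ℂ) + K x) / 2))
      - ((β : ℂ) + Complex.I * (α : ℂ))
        * (∫ x : ℝ, ((B x : ℂ) + ((deriv Bt x : ℝ) : ℂ))
            * Complex.sin (((B x : ℂ) - K x) / 2)) = 0 := by
  have hα0 : 0 < α := by
    rw [hα]
    exact Real.sqrt_pos.mpr (by nlinarith)
  have hαβ : α ^ 2 + β ^ 2 = 1 := by
    rw [hα, Real.sq_sqrt (by nlinarith)]
    ring
  set S := Real.sin (α * x₁) with hS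
  set C := Real.cos (α * x₁) with hC
  have hC0 : C ≠ 0 := by
    intro h
    obtain ⟨k, hk⟩ := Real.cos_eq_zero_iff.mp h
    refine hx₁ k ?_
    field_simp
    linarith
  have hSC : S ^ 2 + C ^ 2 = 1 := Real.sin_sq_add_cos_sq _
  set c : ℝ → ℝ := fun x => Real.cosh (β * (x + x₂)) with hc
  set s : ℝ → ℝ := fun x => Real.sinh (β * (x + x₂)) with hs
  have hc1 : ∀ x, 1 ≤ c x := fun x => Real.one_le_cosh _
  have hcpos : ∀ x, 0 < c x := fun x => Real.cosh_pos _
  have hcs : ∀ x, c x ^ 2 - s x ^ 2 = 1 := fun x => Real.cosh_sq_sub_sinh_sq _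
  have hsc : ∀ x, |s x| ≤ c x := fun x =>
    abs_le_of_sq_le_sq (by linarith [hcs x]) (hcpos x).le
  have hcc : Continuous c := Real.continuous_cosh.comp (by fun_prop)
  have hsC : Continuous s := Real.continuous_sinh.comp (by fun_prop)
  have hlin : ∀ x, HasDerivAt (fun x : ℝ => β * (x + x₂)) β x := fun x => by
    simpa using ((hasDerivAt_id x).add_const x₂).const_mul β
  have hcd : ∀ x, HasDerivAt c (β * s x) x := fun x =>
    (hlin x).cosh.congr_deriv (mul_comm _ _)
  set D : ℝ → ℝ := fun x => α ^ 2 * c x ^ 2 + β ^ 2 * S ^ 2 with hD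
  have hB' : ∀ x, B x = 4 * Real.arctan (β * S / (α * c x)) := hB
  have hDc : ∀ x, α ^ 2 * c x ^ 2 ≤ D x := fun x =>
    le_add_of_nonneg_right (by positivity)
  have hDpos : ∀ x, 0 < D x := fun x =>
    lt_of_lt_of_le (by have := hcpos x; positivity) (hDc x)
  have hDcont : Continuous D := by fun_prop
  have hdiv : ∀ x, c x / D x ≤ 1 / α ^ 2 / c x := fun x => by
    have := hcpos x
    have := hDpos x
    rw [div_div, div_le_div_iff₀ (by positivity) (by positivity)]
    linarith [hDc x]
  -- the derivative of the time-derivative profile of the breather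
  set Btx : ℝ → ℝ := fun x =>
    4 * α ^ 2 * β ^ 2 * C * s x * (β ^ 2 * S ^ 2 - α ^ 2 * c x ^ 2) / D x ^ 2 with hBtxdef
  have hBt' : Bt = fun x => 4 * α ^ 2 * β * C * c x / D x := funext hBt
  have hBtx : deriv Bt = Btx := by
    funext x
    have hDd : HasDerivAt D (α ^ 2 * (2 * c x * (β * s x))) x :=
      ((((hcd x).pow 2).const_mul (α ^ 2)).add_const (β ^ 2 * S ^ 2)).congr_deriv (by simp)
    have h := ((hcd x).const_mul (4 * α ^ 2 * β * C)).div hDd (hDpos x).ne'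
    rw [hBt']
    refine (h.congr_deriv ?_).deriv
    simp only [hBtxdef]
    congr 1
    simp only [hD]
    ring
  -- the complex hyperbolic cosine of the kink phase
  set w : ℝ → ℂ := fun x => c x * C + s x * S * I with hw
  have hwre : ∀ x, (w x).re = c x * C := fun x => by simp [hw]
  have hw0 : ∀ x, w x ≠ 0 := fun x h => by
    have := hwre x
    rw [h, Complex.zero_re] at this
    exact mul_ne_zero (hcpos x).ne' hC0 this.symm
  have hwcont : Continuous w := by fun_prop
  have hwnorm : ∀ x, |C| ≤ ‖w x‖ := fun x => by
    refine le_trans ?_ (Complex.abs_re_le_norm _)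
    rw [hwre, abs_mul, abs_of_pos (hcpos x)]
    exact le_mul_of_one_le_left (abs_nonneg _) (hc1 x)
  have hθ' : ∀ x, θ x = ((β * (x + x₂) : ℝ) : ℂ) + ((α * x₁ : ℝ) : ℂ) * I := fun x => by
    rw [hθ]
    push_cast
    ring
  have hcoshθ : ∀ x, Complex.cosh (θ x) = w x := fun x => by
    rw [hθ', Complex.cosh_add, Complex.cosh_mul_I, Complex.sinh_mul_I, ← Complex.ofReal_cos,
      ← Complex.ofReal_sin, ← Complex.ofReal_cosh, ← Complex.ofReal_sinh]
    simp only [hw, hc, hs, hS, hC]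
    ring
  have hsinhθ : ∀ x, Complex.sinh (θ x) = s x * C + c x * S * I := fun x => by
    rw [hθ', Complex.sinh_add, Complex.cosh_mul_I, Complex.sinh_mul_I, ← Complex.ofReal_cos,
      ← Complex.ofReal_sin, ← Complex.ofReal_cosh, ← Complex.ofReal_sinh]
    simp only [hc, hs, hS, hC]
    ring
  have hKt' : Kt = fun x => 2 * I * α / w x := by
    funext x
    have he := Complex.exp_ne_zero (θ x)
    have hw0x := hw0 x
    rw [hKt, two_mul, Complex.exp_add, ← sq, Complex.one_add_exp_sq, hcoshθ]
    field_simp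
    ring
  have hexpre : ∀ x, (Complex.exp (θ x)).re ≠ 0 := fun x => by
    rw [hθ', Complex.exp_re]
    refine mul_ne_zero (Real.exp_pos _).ne' ?_
    simpa [-Complex.ofReal_mul] using hC0
  have hK' : deriv K = fun x => 2 * β / w x := by
    funext x
    have he := Complex.exp_ne_zero (θ x)
    have hw0x := hw0 x
    have hθd : HasDerivAt θ β x := by
      rw [funext hθ']
      exact ((hlin x).ofReal_comp).add_const _
    rw [funext hK]
    refine HasDerivAt.deriv ?_
    have h := ((Complex.hasDerivAt_arctan_of_re_ne_zero (hexpre x)).comp x hθd.cexp).const_mul 4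
    refine h.congr_deriv ?_
    rw [Complex.one_add_exp_sq, hcoshθ]
    field_simp
    ring
  -- the Bäcklund relations
  set Bx : ℝ → ℝ := fun x => -(4 * β ^ 2 * α * S * s x) / D x with hBx
  have hback : ∀ x,
      Complex.sin (((B x : ℂ) + K x) / 2) =
          (β + I * α) / 2 * (((Bx x : ℂ) - Kt x) + ((Bt x : ℂ) - deriv K x)) ∧
        Complex.sin (((B x : ℂ) - K x) / 2) =
          (β - I * α) / 2 * (((Bx x : ℂ) - Kt x) - ((Bt x : ℂ) - deriv K x)) := fun x => by
    have hc0 : (c x : ℂ) ≠ 0 := Complex.ofReal_ne_zero.mpr (hcpos x).ne'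
    have hα0' : (α : ℂ) ≠ 0 := Complex.ofReal_ne_zero.mpr hα0.ne'
    have hD0 : (α : ℂ) ^ 2 * (c x : ℂ) ^ 2 + (β : ℂ) ^ 2 * (S : ℂ) ^ 2 ≠ 0 := by
      exact_mod_cast (hDpos x).ne'
    have hp : 1 + (β * S / (α * c x) : ℂ) ^ 2 =
        (α ^ 2 * c x ^ 2 + β ^ 2 * S ^ 2) / (α ^ 2 * c x ^ 2) := by
      field_simp
    have hp0 : 1 + (β * S / (α * c x) : ℂ) ^ 2 ≠ 0 := by
      rw [hp]
      exact div_ne_zero hD0 (by positivity)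
    have hBe : (B x : ℂ) / 2 = 2 * Complex.arctan (β * S / (α * c x)) := by
      rw [hB']
      push_cast
      ring
    have hKe : K x / 2 = 2 * Complex.arctan (Complex.exp (θ x)) := by
      rw [hK]
      ring
    have hcθ : Complex.cosh (θ x) ≠ 0 := by
      rw [hcoshθ]
      exact hw0 x
    rw [add_div, sub_div, Complex.sin_add, Complex.sin_sub, hBe, hKe]
    refine backlund_algebra (c := c x) (s := s x) (S := S) (C := C) (by exact_mod_cast hαβ)
      (by exact_mod_cast hcs x) (by exact_mod_cast hSC) hD0 (hw0 x) ?_ ?_ ?_ ?_ ?_ ?_ ?_ ?_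
    · rw [Complex.sin_two_mul_arctan hp0, hp]
      field_simp
    · rw [Complex.cos_two_mul_arctan hp0, hp]
      field_simp
    · rw [Complex.sin_two_mul_arctan_exp hcθ, hcoshθ]
    · rw [Complex.cos_two_mul_arctan_exp hcθ, hcoshθ, hsinhθ]
    · simp [hBx, hD]
    · rw [hBt']
      simp [hD]
    · rw [hK']
    · rw [hKt']
  have hBcont : Continuous B := by
    rw [funext hB']
    refine continuous_const.mul (Real.continuous_arctan.comp ?_)
    exact continuous_const.div (continuous_const.mul hcc) fun x =>
      mul_ne_zero hα0.ne' (hcpos x).ne'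
  have hBtcont : Continuous Bt := by
    rw [hBt']
    exact (continuous_const.mul hcc).div hDcont fun x => (hDpos x).ne'
  have hBxcont : Continuous Bx :=
    (continuous_const.mul hsC).neg.div hDcont fun x => (hDpos x).ne'
  have hBtxcont : Continuous Btx :=
    Continuous.div (by fun_prop) (hDcont.pow 2) fun x => pow_ne_zero 2 (hDpos x).ne'
  have hKtcont : Continuous Kt := by
    rw [hKt']
    exact continuous_const.div hwcont hw0
  have hKxcont : Continuous (deriv K) := by
    rw [hK']
    exact continuous_const.div hwcont hw0
  have hconst : ∀ (a : ℂ) x, ‖a / w x‖ ≤ ‖a‖ / |C| := fun a x => by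
    rw [norm_div]
    exact div_le_div_of_nonneg_left (norm_nonneg _) (abs_pos.mpr hC0) (hwnorm x)
  have hKtb : ∃ M, ∀ x, ‖Kt x‖ ≤ M := ⟨_, by rw [hKt']; exact hconst _⟩
  have hKxb : ∃ M, ∀ x, ‖deriv K x‖ ≤ M := ⟨_, by rw [hK']; exact hconst _⟩
  have hdiv' : ∀ x, c x / D x ≤ 1 / α ^ 2 := fun x =>
    (hdiv x).trans (div_le_self (by positivity) (hc1 x))
  have hBtb : ∃ M, ∀ x, |Bt x| ≤ M := by
    refine ⟨|4 * α ^ 2 * β * C| * (1 / α ^ 2), fun x => ?_⟩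
    rw [hBt']
    simp only
    rw [mul_div_assoc, abs_mul, abs_of_pos (div_pos (hcpos x) (hDpos x))]
    exact mul_le_mul_of_nonneg_left (hdiv' x) (abs_nonneg _)
  have hBxb : ∃ M, ∀ x, |Bx x| ≤ M := by
    refine ⟨|4 * β ^ 2 * α * S| * (1 / α ^ 2), fun x => ?_⟩
    simp only [hBx]
    rw [neg_div, abs_neg, mul_div_assoc, abs_mul, abs_div, abs_of_pos (hDpos x)]
    refine mul_le_mul_of_nonneg_left (le_trans ?_ (hdiv' x)) (abs_nonneg _)
    exact div_le_div_of_nonneg_right (hsc x) (hDpos x).le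
  have hBdecay : ∃ M, ∀ x, |B x| ≤ M / c x := by
    refine ⟨4 * |β * S / α|, fun x => ?_⟩
    rw [hB', abs_mul, abs_of_pos (four_pos : (0 : ℝ) < 4), mul_div_assoc 4]
    refine mul_le_mul_of_nonneg_left ((Real.abs_arctan_le_abs _).trans_eq ?_) four_pos.le
    rw [← div_div, abs_div, abs_of_pos (hcpos x)]
  have hBtxdecay : ∃ M, ∀ x, |Btx x| ≤ M / c x := by
    refine ⟨|4 * α ^ 2 * β ^ 2 * C| * (1 / α ^ 2), fun x => ?_⟩
    have h₁ : |β ^ 2 * S ^ 2 - α ^ 2 * c x ^ 2| ≤ D x := by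
      have h₂ : 0 ≤ β ^ 2 * S ^ 2 := by positivity
      have h₃ : 0 ≤ α ^ 2 * c x ^ 2 := by positivity
      simp only [hD]
      exact abs_le.mpr ⟨by linarith, by linarith⟩
    have h₄ := hDpos x
    simp only [hBtxdef]
    rw [abs_div, abs_mul, abs_mul, abs_of_pos (pow_pos h₄ 2), mul_div_assoc]
    calc _ ≤ |4 * α ^ 2 * β ^ 2 * C| * c x * D x / D x ^ 2 := by
          rw [mul_div_assoc]
          gcongr
          exact hsc x
      _ = |4 * α ^ 2 * β ^ 2 * C| * (c x / D x) := by
          field_simp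
      _ ≤ |4 * α ^ 2 * β ^ 2 * C| * (1 / α ^ 2 / c x) :=
          mul_le_mul_of_nonneg_left (hdiv x) (abs_nonneg _)
      _ = _ := by ring
  obtain ⟨MKt, hMKt⟩ := hKtb
  obtain ⟨MKx, hMKx⟩ := hKxb
  obtain ⟨MBt, hMBt⟩ := hBtb
  obtain ⟨MBx, hMBx⟩ := hBxb
  obtain ⟨MB, hMB⟩ := hBdecay
  obtain ⟨MBtx, hMBtx⟩ := hBtxdecay
  have hXb : ∀ x, ‖(Bx x : ℂ) - Kt x‖ ≤ MBx + MKt := fun x =>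
    (norm_sub_le _ _).trans (add_le_add (by simpa using hMBx x) (hMKt x))
  have hYb : ∀ x, ‖(Bt x : ℂ) - deriv K x‖ ≤ MBt + MKx := fun x =>
    (norm_sub_le _ _).trans (add_le_add (by simpa using hMBt x) (hMKx x))
  have hI₁ : Integrable fun x : ℝ => (Btx x : ℂ) * deriv K x :=
    integrable_mul_of_abs_le_div_cosh hβ0.ne' hBtxcont hKxcont hMBtx hMKx
  have hI₂ : Integrable fun x : ℝ => (B x : ℂ) * Kt x :=
    integrable_mul_of_abs_le_div_cosh hβ0.ne' hBcont hKtcont hMB hMKt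
  have hI₃ : Integrable fun x : ℝ =>
      ((B x : ℂ) - (Btx x : ℂ)) * Complex.sin (((B x : ℂ) + K x) / 2) := by
    simp_rw [fun x => (hback x).1, ← Complex.ofReal_sub (B _) (Btx _)]
    refine integrable_mul_of_abs_le_div_cosh (a := x₂) (M := MB + MBtx)
      (M' := ‖((β : ℂ) + I * α) / 2‖ * ((MBx + MKt) + (MBt + MKx))) hβ0.ne'
      (hBcont.sub hBtxcont) (by fun_prop) (fun x => ?_) (fun x => ?_)
    · rw [add_div]
      exact (abs_sub _ _).trans (add_le_add (hMB x) (hMBtx x))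
    · rw [norm_mul]
      exact mul_le_mul_of_nonneg_left ((norm_add_le _ _).trans (add_le_add (hXb x) (hYb x)))
        (norm_nonneg _)
  have hI₄ : Integrable fun x : ℝ =>
      ((B x : ℂ) + (Btx x : ℂ)) * Complex.sin (((B x : ℂ) - K x) / 2) := by
    simp_rw [fun x => (hback x).2, ← Complex.ofReal_add (B _) (Btx _)]
    refine integrable_mul_of_abs_le_div_cosh (a := x₂) (M := MB + MBtx)
      (M' := ‖((β : ℂ) - I * α) / 2‖ * ((MBx + MKt) + (MBt + MKx))) hβ0.ne'
      (hBcont.add hBtxcont) (by fun_prop) (fun x => ?_) (fun x => ?_)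
    · rw [add_div]
      exact (abs_add_le _ _).trans (add_le_add (hMB x) (hMBtx x))
    · rw [norm_mul]
      exact mul_le_mul_of_nonneg_left ((norm_sub_le _ _).trans (add_le_add (hXb x) (hYb x)))
        (norm_nonneg _)
  rw [hBtx]
  refine ⟨hI₁, hI₂, hI₃, hI₄, ?_⟩
  -- parity about the point `-x₂`
  have hrefl : ∀ x, β * (-(2 * x₂) - x + x₂) = -(β * (x + x₂)) := fun x => by ring
  have hcr : ∀ x, c (-(2 * x₂) - x) = c x := fun x => by
    simp only [hc]
    rw [hrefl, Real.cosh_neg]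
  have hsr : ∀ x, s (-(2 * x₂) - x) = -s x := fun x => by
    simp only [hs]
    rw [hrefl, Real.sinh_neg]
  have hDr : ∀ x, D (-(2 * x₂) - x) = D x := fun x => by
    simp only [hD, hcr]
  have hBr : ∀ x, B (-(2 * x₂) - x) = B x := fun x => by
    rw [hB', hB', hcr]
  have hBtr : ∀ x, Bt (-(2 * x₂) - x) = Bt x := fun x => by
    simp only [hBt', hcr, hDr]
  have hBxr : ∀ x, Bx (-(2 * x₂) - x) = -Bx x := fun x => by
    simp only [hBx, hsr, hDr]
    ring
  have hBtxr : ∀ x, Btx (-(2 * x₂) - x) = -Btx x := fun x => by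
    simp only [hBtxdef, hsr, hcr, hDr]
    ring
  have hwr : ∀ x, w (-(2 * x₂) - x) = (starRingEnd ℂ) (w x) := fun x => by
    simp only [hw, hcr, hsr]
    simp
  have hre₁ := re_integral_eq_zero_of_comp_sub_left (f := fun x : ℝ => (Btx x : ℂ) * deriv K x)
    (-(2 * x₂)) fun x => by
      simp only [hBtxr, hK', hwr]
      simp [map_ofNat (starRingEnd ℂ) 2]
  have hre₂ := re_integral_eq_zero_of_comp_sub_left (f := fun x : ℝ => (B x : ℂ) * Kt x)
    (-(2 * x₂)) fun x => by
      simp only [hBr, hKt', hwr]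
      simp [neg_div, map_ofNat (starRingEnd ℂ) 2]
  have hodd := integral_eq_zero_of_comp_sub_left
    (f := fun x : ℝ => (B x : ℂ) * Bx x - (Btx x : ℂ) * Bt x) (-(2 * x₂)) fun x => by
      simp only [hBr, hBtr, hBxr, hBtxr]
      push_cast
      ring
  have him : ∀ z : ℂ, z.re = 0 → I * ((z.im : ℝ) : ℂ) = z := fun z hz => by
    apply Complex.ext <;> simp [hz]
  rw [him _ hre₁, him _ hre₂]
  have hab : ((β : ℂ) + I * α) * ((β : ℂ) - I * α) = 1 := by
    have : (α : ℂ) ^ 2 + (β : ℂ) ^ 2 = 1 := by exact_mod_cast hαβ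
    linear_combination this - (α : ℂ) ^ 2 * I_sq
  have hI₁₂ : Integrable fun x : ℝ => (Btx x : ℂ) * deriv K x - (B x : ℂ) * Kt x := hI₁.sub hI₂
  have hI₁₂₃ : Integrable fun x : ℝ => (Btx x : ℂ) * deriv K x - (B x : ℂ) * Kt x -
      ((β : ℂ) - I * α) * (((B x : ℂ) - (Btx x : ℂ)) * Complex.sin (((B x : ℂ) + K x) / 2)) :=
    hI₁₂.sub (hI₃.const_mul _)
  rw [one_div, inv_eq_of_mul_eq_one_right hab, ← integral_const_mul, ← integral_const_mul,
    ← integral_sub hI₁ hI₂, ← integral_sub hI₁₂ (hI₃.const_mul _),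
    ← integral_sub hI₁₂₃ (hI₄.const_mul _), ← neg_eq_zero,
    ← integral_neg, ← hodd]
  refine integral_congr_ae (Filter.Eventually.of_forall fun x => ?_)
  simp only
  rw [(hback x).1, (hback x).2]
  linear_combination ((B x : ℂ) * ((Bx x : ℂ) - Kt x) - Btx x * ((Bt x : ℂ) - deriv K x)) * hab
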